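/- Let A be an m×n complex matrix of rank r. Then for every i ∈ {1,…,m} and j ∈ {1,…,n}, the m×m matrix (AA*)_{i.}(a*_{j.}), obtained from AA* by replacing its i-th row with the j-th row of A*, has rank at most r. -/

import Mathlib

open Matrix

/-- The principal minor of a square matrix `M` determined by the subset `β` of indices. -/
noncomputable def Matrix.pminor {n : Type*} [DecidableEq n] [Fintype n]
    (M : Matrix n n ℂ) (β : Finset n) : ℂ :=
  (M.submatrix (fun i : {x // x ∈ β} => i.1) (fun i : {x // x ∈ β} => i.1)).det

/-- If `A` is an `m × n` complex matrix of rank `r`, then for every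
`i ∈ {1,…,m}` and `j ∈ {1,…,n}`, the `m × m` matrix obtained from `AAᴴ` by replacing its
`i`-th row with the `j`-th row of `Aᴴ` has rank at most `r`. -/
theorem rank_updateRow_self_mul_conjTranspose_le
    (m n r : ℕ) (A : Matrix (Fin m) (Fin n) ℂ) (hA : A.rank = r)
    (i : Fin m) (j : Fin n) :
    ((A * Aᴴ).updateRow i (fun k => Aᴴ j k)).rank ≤ r := by
  have h : (A * Aᴴ).updateRow i (fun k => Aᴴ j k)
      = (A.updateRow i (Pi.single j 1)) * Aᴴ := by
    rw [updateRow_mul, single_one_vecMul]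
    rfl
  have h2 : Aᴴ.rank = A.rank := by
    open scoped ComplexOrder in
    exact rank_conjTranspose A
  rw [h, ← hA, ← h2]
  exact rank_mul_le_right _ _
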